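/- Let H = ℓ² with the masa D of diagonal operators with respect to the standard orthonormal basis (e_n), and let κ ⊆ ℕ×ℕ be a Schur bounded pattern. Then the Schur idempotent Φ_κ of Schur multiplication by the 0-1 matrix of κ (i.e., the weak* continuous D-bimodule map with ⟨Φ_κ(T)e_j, e_i⟩ = ⟨Te_j, e_i⟩ if (i,j) ∈ κ and = 0 otherwise) belongs to 𝔉H; in particular ran Φ_κ is hyperreflexive. -/

import Mathlib

open scoped InnerProductSpace Pointwise

noncomputable section

namespace SchurHyper

/-- `B H` is the algebra of bounded linear operators on `H`. -/
abbrev B (H : Type*) [NormedAddCommGroup H] [InnerProductSpace ℂ H] : Type _ := H →L[ℂ] H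

variable (H : Type*) [NormedAddCommGroup H] [InnerProductSpace ℂ H]

/-- A linear functional on `B H` is *normal* (weak* continuous) if it arises from
the duality with the trace class, i.e. it is of the form
`T ↦ ∑ₙ ⟪yₙ, T xₙ⟫` for square-summable sequences `(xₙ)`, `(yₙ)`
(recall that the inner product is conjugate-linear in its first slot). -/
def IsNormalFunctional (ω : B H →ₗ[ℂ] ℂ) : Prop :=
  ∃ x y : ℕ → H, Summable (fun n => ‖x n‖ ^ 2) ∧ Summable (fun n => ‖y n‖ ^ 2) ∧
    ∀ T : B H, ω T = ∑' n, ⟪y n, T (x n)⟫_ℂ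

/-- The weak* topology on `B H`: the topology induced by the normal functionals. -/
def weakStarTopology : TopologicalSpace (B H) :=
  TopologicalSpace.induced
    (fun (T : B H) (ω : {ω : B H →ₗ[ℂ] ℂ // IsNormalFunctional H ω}) => ω.1 T)
    inferInstance

/-- A set of operators is weak* closed if it is closed in the weak* topology. -/
def WStarClosed (X : Set (B H)) : Prop := @IsClosed _ (weakStarTopology H) X

/-- The weak* closure of a set of operators. -/
def wStarClosure (X : Set (B H)) : Set (B H) := @closure _ (weakStarTopology H) X

/-- A map on `B H` is weak* continuous if it is continuous with respect to the
weak* topology on both sides. -/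
def WStarContinuous (Φ : B H →L[ℂ] B H) : Prop :=
  @Continuous _ _ (weakStarTopology H) (weakStarTopology H) Φ

variable {H}
variable [CompleteSpace H]

/-- A maximal abelian selfadjoint subalgebra of `B H`: an abelian selfadjoint
subalgebra which contains every operator commuting with it (equivalently, it
coincides with its own commutant). -/
def IsMasa (D : StarSubalgebra ℂ (B H)) : Prop :=
  (∀ A ∈ D, ∀ C ∈ D, A * C = C * A) ∧
  (∀ T : B H, (∀ A ∈ D, T * A = A * T) → T ∈ D)

/-- A Schur multiplier: a weak* continuous `D`-bimodule map on `B H`. -/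
def IsSchurMultiplier (D : StarSubalgebra ℂ (B H)) (Φ : B H →L[ℂ] B H) : Prop :=
  WStarContinuous H Φ ∧ ∀ A ∈ D, ∀ C ∈ D, ∀ T : B H, Φ (A * T * C) = A * Φ T * C

/-- A Schur idempotent: an idempotent Schur multiplier. -/
def IsSchurIdempotent (D : StarSubalgebra ℂ (B H)) (Φ : B H →L[ℂ] B H) : Prop :=
  IsSchurMultiplier D Φ ∧ Φ.comp Φ = Φ

/-- A subspace `X ⊆ B H` is a `D`-bimodule if `D X D ⊆ X`. -/
def IsBimodule (D : StarSubalgebra ℂ (B H)) (X : Submodule ℂ (B H)) : Prop :=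
  ∀ A ∈ D, ∀ C ∈ D, ∀ T ∈ X, A * T * C ∈ X

/-- The Arveson distance `α(T, X)`. -/
def arveson (T : B H) (X : Set (B H)) : ℝ :=
  ⨆ ξ : {ξ : H // ‖ξ‖ = 1}, ⨅ S : X, ‖T ξ.1 - S.1 ξ.1‖

/-- The set of hyperreflexivity constants of `X`. -/
def hyperSet (X : Set (B H)) : Set ℝ :=
  {k | 0 < k ∧ ∀ T : B H, Metric.infDist T X ≤ k * arveson T X}

/-- A subspace is hyperreflexive if `d(T, X) ≤ k ⬝ α(T, X)` for some `k > 0`. -/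
def Hyperreflexive (X : Set (B H)) : Prop := (hyperSet X).Nonempty

/-- The hyperreflexivity constant `k(X)`: the least constant that works. -/
def hyperConst (X : Set (B H)) : ℝ := sInf (hyperSet X)

/-- The set of constants `λ` witnessing that a Schur idempotent lies in `𝔉H`. -/
def lamSet (Φ : B H →L[ℂ] B H) : Set ℝ :=
  {l | 0 < l ∧ ∀ T : B H, ‖T - Φ T‖ ≤ l * arveson T (Set.range Φ)}

/-- The class `𝔉H` of Schur idempotents `Φ` such that
`‖T - Φ T‖ ≤ λ ⬝ α(T, ran Φ)` for some `λ > 0` and all `T`. -/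
def MemFH (D : StarSubalgebra ℂ (B H)) (Φ : B H →L[ℂ] B H) : Prop :=
  IsSchurIdempotent D Φ ∧ (lamSet Φ).Nonempty

/-- The constant `λ(Φ)`: the least constant witnessing membership of `𝔉H`. -/
def lam (Φ : B H →L[ℂ] B H) : ℝ := sInf (lamSet Φ)

/-- A ternary masa-bimodule condition: `S T* R ∈ M` whenever `S, T, R ∈ M`. -/
def IsTernary (M : Submodule ℂ (B H)) : Prop :=
  ∀ S ∈ M, ∀ T ∈ M, ∀ R ∈ M, S * star T * R ∈ M

end SchurHyper

open SchurHyper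

/-- The standard orthonormal basis of `ℓ²`. -/
noncomputable def e (n : ℕ) : lp (fun _ : ℕ => ℂ) 2 := lp.single 2 n 1

/-- The Hilbert space `ℓ²(ℕ)`. -/
local notation "ℓ²" => lp (fun _ : ℕ => ℂ) 2

/-- The vector of `ℓ²` with coordinates `x j` for `j ∈ s` and zero otherwise. -/
def vec (s : Finset ℕ) (x : ℕ → ℂ) : ℓ² := ∑ j ∈ s, x j • e j

theorem inner_e (i : ℕ) (f : ℓ²) : ⟪e i, f⟫_ℂ = f i := by
  simp [e, lp.inner_single_left]

theorem e_apply (i j : ℕ) : (e j : ℓ²) i = if i = j then 1 else 0 := by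
  simp [e, lp.single_apply, Pi.single_apply]

theorem inner_e_e (i j : ℕ) : ⟪e i, e j⟫_ℂ = if i = j then 1 else 0 := by
  rw [inner_e, e_apply]

theorem orthonormal_e : Orthonormal ℂ e := by
  rw [orthonormal_iff_ite]
  exact inner_e_e

theorem norm_e (i : ℕ) : ‖e i‖ = 1 := orthonormal_e.1 i

theorem inner_vec_vec (s t : Finset ℕ) (x y : ℕ → ℂ) (T : B ℓ²) :
    ⟪vec s y, T (vec t x)⟫_ℂ =
      ∑ i ∈ s, ∑ j ∈ t, starRingEnd ℂ (y i) * x j * ⟪e i, T (e j)⟫_ℂ := by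
  simp only [vec, map_sum, map_smul, sum_inner, inner_sum, inner_smul_left, inner_smul_right]
  rw [Finset.sum_comm]
  refine Finset.sum_congr rfl fun i _ => ?_
  rw [Finset.mul_sum]
  refine Finset.sum_congr rfl fun j _ => ?_
  ring

theorem norm_vec_sq (s : Finset ℕ) (x : ℕ → ℂ) : ‖vec s x‖ ^ 2 = ∑ j ∈ s, ‖x j‖ ^ 2 := by
  have h := orthonormal_e.inner_sum x x s
  have h2 : ((‖vec s x‖ ^ 2 : ℝ) : ℂ) = ((∑ j ∈ s, ‖x j‖ ^ 2 : ℝ) : ℂ) := by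
    push_cast
    refine (inner_self_eq_norm_sq_to_K (𝕜 := ℂ) (vec s x)).symm.trans
      (h.trans (Finset.sum_congr rfl fun j _ => ?_))
    rw [Complex.conj_mul']
  exact_mod_cast h2

theorem norm_vec (s : Finset ℕ) (x : ℕ → ℂ) : ‖vec s x‖ = √(∑ j ∈ s, ‖x j‖ ^ 2) := by
  rw [← norm_vec_sq, Real.sqrt_sq (norm_nonneg _)]

theorem hasSum_e (f : ℓ²) : HasSum (fun i => f i • e i) f := by
  convert! lp.hasSum_single (p := 2) (by simp) f using 2 with i
  rw [e, ← lp.single_smul]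
  simp

theorem tendsto_vec (f : ℓ²) :
    Filter.Tendsto (fun n => vec (Finset.range n) f) Filter.atTop (nhds f) :=
  (hasSum_e f).tendsto_sum_nat

/-- A bound on the finitary sections of an operator bounds its norm. -/
theorem opNorm_le_of_sections (T : B ℓ²) (K : ℝ) (hK : 0 ≤ K)
    (h : ∀ (n : ℕ) (x y : ℕ → ℂ), ‖⟪vec (Finset.range n) y, T (vec (Finset.range n) x)⟫_ℂ‖ ≤
      K * ‖vec (Finset.range n) x‖ * ‖vec (Finset.range n) y‖) : ‖T‖ ≤ K := by
  have key : ∀ f g : ℓ², ‖⟪g, T f⟫_ℂ‖ ≤ K * ‖f‖ * ‖g‖ := by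
    intro f g
    have hf := tendsto_vec f
    have hg := tendsto_vec g
    refine le_of_tendsto_of_tendsto' ?_ ((tendsto_const_nhds.mul hf.norm).mul hg.norm)
      (fun n => h n f g)
    exact (hg.inner ((T.continuous.tendsto f).comp hf)).norm
  refine T.opNorm_le_bound hK fun f => ?_
  have h1 := key f (T f)
  rw [inner_self_eq_norm_sq_to_K] at h1
  simp only [Complex.coe_algebraMap, norm_pow, Complex.norm_real, norm_norm] at h1
  rcases (norm_nonneg (T f)).eq_or_lt with h0 | h0
  · rw [← h0]; positivity
  · nlinarith

/-- Operators are determined by their matrix entries. -/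
theorem ext_entries {S T : B ℓ²} (h : ∀ i j, ⟪e i, S (e j)⟫_ℂ = ⟪e i, T (e j)⟫_ℂ) : S = T := by
  rw [← sub_eq_zero, ← norm_eq_zero]
  refine le_antisymm (opNorm_le_of_sections _ 0 le_rfl fun n x y => ?_) (norm_nonneg _)
  simp [inner_vec_vec, h]

theorem inner_diag_left {A : B ℓ²} (hA : ∀ i j : ℕ, i ≠ j → ⟪e i, A (e j)⟫_ℂ = 0) (i : ℕ)
    (f : ℓ²) : ⟪e i, A f⟫_ℂ = ⟪e i, A (e i)⟫_ℂ * ⟪e i, f⟫_ℂ := by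
  have h1 : HasSum (fun j => ⟪e i, A (f j • e j)⟫_ℂ) ⟪e i, A f⟫_ℂ :=
    (hasSum_e f).mapL ((innerSL ℂ (e i)).comp A)
  have h2 : HasSum (fun j => ⟪e i, A (f j • e j)⟫_ℂ) ⟪e i, A (f i • e i)⟫_ℂ := by
    refine hasSum_single i fun j hj => ?_
    rw [map_smul, inner_smul_right, hA i j hj.symm, mul_zero]
  rw [h1.unique h2, map_smul, inner_smul_right, inner_e i f, mul_comm]

theorem diag_apply_e {A : B ℓ²} (hA : ∀ i j : ℕ, i ≠ j → ⟪e i, A (e j)⟫_ℂ = 0) (j : ℕ) :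
    A (e j) = ⟪e j, A (e j)⟫_ℂ • e j := by
  ext i
  by_cases h : i = j
  · subst h; simp [e_apply, inner_e]
  · have := hA i j h
    rw [inner_e] at this
    simp [this, e_apply, h]

theorem le_arveson {X : Set (B ℓ²)} (T : B ℓ²) (h0 : (0 : B ℓ²) ∈ X) {a : ℝ} (x : ℓ²) (hx : x ≠ 0)
    (h : ∀ S ∈ X, a * ‖x‖ ≤ ‖T x - S x‖) : a ≤ arveson T X := by
  have hx' : 0 < ‖x‖ := norm_pos_iff.2 hx
  have hbdd : BddAbove (Set.range fun ξ : {ξ : ℓ² // ‖ξ‖ = 1} =>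
      ⨅ S : X, ‖T ξ.1 - S.1 ξ.1‖) := by
    refine ⟨‖T‖, ?_⟩
    rintro _ ⟨ξ, rfl⟩
    refine (ciInf_le ⟨0, ?_⟩ (⟨0, h0⟩ : X)).trans ?_
    · rintro _ ⟨S, rfl⟩; exact norm_nonneg _
    · simpa [ξ.2] using T.le_opNorm ξ.1
  have hn : ‖((‖x‖⁻¹ : ℝ) : ℂ) • x‖ = 1 := by
    rw [norm_smul, Complex.norm_real, norm_inv, norm_norm, inv_mul_cancel₀ hx'.ne']
  have : Nonempty X := ⟨⟨0, h0⟩⟩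
  refine le_trans ?_ (le_ciSup hbdd ⟨((‖x‖⁻¹ : ℝ) : ℂ) • x, hn⟩)
  refine le_ciInf fun S => ?_
  have h2 := h S.1 S.2
  rw [map_smul, map_smul, ← smul_sub, norm_smul, Complex.norm_real, norm_inv, norm_norm,
    inv_mul_eq_div, le_div_iff₀ hx']
  exact h2

theorem arveson_nonneg (X : Set (B ℓ²)) (T : B ℓ²) : 0 ≤ arveson T X :=
  Real.iSup_nonneg fun _ => Real.iInf_nonneg fun _ => norm_nonneg _

/-- Compressions of `T` to rectangles disjoint from the support of `X` are bounded by the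
Arveson distance from `T` to `X`. -/
theorem norm_rectangle_le {X : Set (B ℓ²)} (T : B ℓ²) (h0 : (0 : B ℓ²) ∈ X) (E F : Finset ℕ)
    (hEF : ∀ S ∈ X, ∀ i ∈ E, ∀ j ∈ F, ⟪e i, S (e j)⟫_ℂ = 0) (x y : ℕ → ℂ) :
    ‖⟪vec E y, T (vec F x)⟫_ℂ‖ ≤ arveson T X * ‖vec F x‖ * ‖vec E y‖ := by
  by_cases hx : vec F x = 0
  · simp [hx]
  by_cases hy : vec E y = 0
  · simp [hy]
  have hx' : 0 < ‖vec F x‖ := norm_pos_iff.2 hx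
  have hy' : 0 < ‖vec E y‖ := norm_pos_iff.2 hy
  have : ‖⟪vec E y, T (vec F x)⟫_ℂ‖ / (‖vec F x‖ * ‖vec E y‖) ≤ arveson T X := by
    refine le_arveson T h0 _ hx fun S hS => ?_
    have hz : ⟪vec E y, S (vec F x)⟫_ℂ = 0 := by
      rw [inner_vec_vec]
      exact Finset.sum_eq_zero fun i hi => Finset.sum_eq_zero fun j hj => by
        rw [hEF S hS i hi j hj, mul_zero]
    have h1 : ‖⟪vec E y, T (vec F x)⟫_ℂ‖ ≤ ‖vec E y‖ * ‖T (vec F x) - S (vec F x)‖ := by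
      rw [← sub_zero ⟪vec E y, T (vec F x)⟫_ℂ, ← hz, ← inner_sub_right]
      exact norm_inner_le_norm _ _
    rw [div_mul_eq_mul_div, div_le_iff₀ (by positivity)]
    nlinarith
  rw [div_le_iff₀ (by positivity)] at this
  linarith

/-- The number of subsets of `s` containing `i` and avoiding `c`. -/
theorem card_filter_mem_disjoint {s c : Finset ℕ} {i : ℕ} (hi : i ∈ s) (hic : i ∉ c)
    (hc : c ⊆ s) :
    (((s.powerset.filter fun A => i ∈ A ∧ Disjoint A c).card : ℕ) : ℂ) * (2 * 2 ^ c.card) =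
      2 ^ s.card := by
  have h1 : (s.powerset.filter fun A => i ∈ A ∧ Disjoint A c) = Finset.Icc {i} (s \ c) := by
    ext A
    simp only [Finset.mem_filter, Finset.mem_powerset, Finset.mem_Icc,
      Finset.singleton_subset_iff, Finset.subset_sdiff]
    tauto
  have h2 : {i} ⊆ s \ c := by simp [hi, hic]
  have h3 := Finset.card_sdiff_add_card_eq_card hc
  have h4 := Finset.card_le_card h2
  rw [Finset.card_singleton] at h4
  rw [h1, Finset.card_Icc_finset h2, Finset.card_singleton]
  push_cast
  rw [← pow_succ', ← pow_add]
  congr 1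
  lia

open Classical in
/-- If the pattern `κ` is the union of a set with at most `N` entries in each row and a set with
at most `N` entries in each column, then an operator supported off `κ` is controlled by its
compressions to rectangles disjoint from `κ`. -/
theorem norm_le_of_rectangles {κ κr κc : Set (ℕ × ℕ)} (hκ : κ = κr ∪ κc) (N : ℕ)
    (hr : ∀ (i : ℕ) (s : Finset ℕ), (∀ j ∈ s, (i, j) ∈ κr) → s.card ≤ N)
    (hc : ∀ (j : ℕ) (s : Finset ℕ), (∀ i ∈ s, (i, j) ∈ κc) → s.card ≤ N)
    (T : B ℓ²) (hT : ∀ i j, (i, j) ∈ κ → ⟪e i, T (e j)⟫_ℂ = 0) (a : ℝ) (ha : 0 ≤ a)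
    (h : ∀ E F : Finset ℕ, (∀ i ∈ E, ∀ j ∈ F, (i, j) ∉ κ) → ∀ x y : ℕ → ℂ,
      ‖⟪vec E y, T (vec F x)⟫_ℂ‖ ≤ a * ‖vec F x‖ * ‖vec E y‖) :
    ‖T‖ ≤ 4 ^ (N + 1) * a := by
  refine opNorm_le_of_sections T _ (by positivity) fun n x y => ?_
  set s := Finset.range n with hs
  set R : ℕ → Finset ℕ := fun i => s.filter fun j => (i, j) ∈ κr with hR
  set C : ℕ → Finset ℕ := fun j => s.filter fun i => (i, j) ∈ κc with hC
  have hRN : ∀ i, (R i).card ≤ N := fun i => hr i _ fun j hj => (Finset.mem_filter.1 hj).2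
  have hCN : ∀ j, (C j).card ≤ N := fun j => hc j _ fun i hi => (Finset.mem_filter.1 hi).2
  set y' : ℕ → ℂ := fun i => y i * (2 * 2 ^ (R i).card) with hy'
  set x' : ℕ → ℂ := fun j => x j * (2 * 2 ^ (C j).card) with hx'
  set E : Finset ℕ → Finset ℕ → Finset ℕ := fun A F => A.filter fun i => Disjoint F (R i) with hE
  set G : Finset ℕ → Finset ℕ → Finset ℕ := fun A F => F.filter fun j => Disjoint A (C j) with hG
  have hvec : ∀ (z : ℕ → ℂ) (c : ℕ → ℕ), (∀ i, c i ≤ N) → ∀ t ⊆ s,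
      ‖vec t (fun i => z i * (2 * 2 ^ c i))‖ ≤ 2 ^ (N + 1) * ‖vec s z‖ := by
    intro z c hcN t ht
    refine le_of_sq_le_sq ?_ (by positivity)
    rw [mul_pow, norm_vec_sq, norm_vec_sq, Finset.mul_sum]
    refine (Finset.sum_le_sum_of_subset_of_nonneg ht fun _ _ _ => sq_nonneg _).trans ?_
    refine Finset.sum_le_sum fun i _ => ?_
    rw [norm_mul, mul_pow, mul_comm]
    refine mul_le_mul_of_nonneg_right ?_ (sq_nonneg _)
    rw [← pow_succ', norm_pow, Complex.norm_ofNat]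
    gcongr
    · norm_num
    · exact hcN i
  have hoff : ∀ A ⊆ s, ∀ F ⊆ s, ∀ i ∈ E A F, ∀ j ∈ G A F, (i, j) ∉ κ := by
    intro A hA F hF i hi j hj hij
    rw [Finset.mem_filter] at hi hj
    rw [hκ] at hij
    rcases hij with hij | hij
    · exact Finset.disjoint_left.1 hi.2 hj.1 (Finset.mem_filter.2 ⟨hF hj.1, hij⟩)
    · exact Finset.disjoint_left.1 hj.2 hi.1 (Finset.mem_filter.2 ⟨hA hi.1, hij⟩)
  have hsum : ∑ A ∈ s.powerset, ∑ F ∈ s.powerset, ⟪vec (E A F) y', T (vec (G A F) x')⟫_ℂ =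
      (2 ^ s.card) ^ 2 * ⟪vec s y, T (vec s x)⟫_ℂ := by
    have h1 : ∀ A ∈ s.powerset, ∀ F ∈ s.powerset, ⟪vec (E A F) y', T (vec (G A F) x')⟫_ℂ =
        ∑ i ∈ s, ∑ j ∈ s, (if i ∈ A ∧ Disjoint A (C j) then 1 else 0) *
          (if j ∈ F ∧ Disjoint F (R i) then 1 else 0) *
          (starRingEnd ℂ (y' i) * x' j * ⟪e i, T (e j)⟫_ℂ) := by
      intro A hA F hF
      rw [Finset.mem_powerset] at hA hF
      rw [inner_vec_vec]
      have hEs : E A F ⊆ s := (Finset.filter_subset _ _).trans hA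
      have hGs : G A F ⊆ s := (Finset.filter_subset _ _).trans hF
      rw [← Finset.sum_subset hEs]
      · refine Finset.sum_congr rfl fun i hi => ?_
        rw [← Finset.sum_subset hGs]
        · refine Finset.sum_congr rfl fun j hj => ?_
          rw [Finset.mem_filter] at hi hj
          simp [hi, hj]
        · intro j _ hj
          rw [Finset.mem_filter] at hi hj
          have : ¬ ((i ∈ A ∧ Disjoint A (C j)) ∧ (j ∈ F ∧ Disjoint F (R i))) := by tauto
          rw [ite_zero_mul_ite_zero, if_neg this, zero_mul]
      · intro i _ hi
        refine Finset.sum_eq_zero fun j _ => ?_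
        rw [Finset.mem_filter] at hi
        have : ¬ ((i ∈ A ∧ Disjoint A (C j)) ∧ (j ∈ F ∧ Disjoint F (R i))) := by tauto
        rw [ite_zero_mul_ite_zero, if_neg this, zero_mul]
    rw [Finset.sum_congr rfl fun A hA => Finset.sum_congr rfl fun F hF => h1 A hA F hF]
    have h2 : ∀ i ∈ s, ∀ j ∈ s, ∑ A ∈ s.powerset, ∑ F ∈ s.powerset,
        (if i ∈ A ∧ Disjoint A (C j) then (1 : ℂ) else 0) *
          (if j ∈ F ∧ Disjoint F (R i) then 1 else 0) *
          (starRingEnd ℂ (y' i) * x' j * ⟪e i, T (e j)⟫_ℂ) =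
        (2 ^ s.card) ^ 2 * (starRingEnd ℂ (y i) * x j * ⟪e i, T (e j)⟫_ℂ) := by
      intro i hi j hj
      by_cases hij : (i, j) ∈ κ
      · simp [hT i j hij]
      have hiC : i ∉ C j := fun h' => hij (hκ ▸ Or.inr (Finset.mem_filter.1 h').2)
      have hjR : j ∉ R i := fun h' => hij (hκ ▸ Or.inl (Finset.mem_filter.1 h').2)
      have c1 := card_filter_mem_disjoint hi hiC (Finset.filter_subset _ _)
      have c2 := card_filter_mem_disjoint hj hjR (Finset.filter_subset _ _)
      simp_rw [← Finset.sum_mul, ← Finset.mul_sum, ← Finset.sum_mul, Finset.sum_boole]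
      have hyc : starRingEnd ℂ (y' i) = starRingEnd ℂ (y i) * (2 * 2 ^ (R i).card) := by
        simp only [hy', map_mul, map_pow, Complex.conj_ofNat]
      rw [hyc, hx', sq]
      nth_rewrite 1 [← c1]
      rw [← c2]
      ring
    calc _ = ∑ i ∈ s, ∑ j ∈ s, ∑ A ∈ s.powerset, ∑ F ∈ s.powerset,
        (if i ∈ A ∧ Disjoint A (C j) then (1 : ℂ) else 0) *
          (if j ∈ F ∧ Disjoint F (R i) then 1 else 0) *
          (starRingEnd ℂ (y' i) * x' j * ⟪e i, T (e j)⟫_ℂ) := by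
          simp_rw [Finset.sum_comm (s := s.powerset) (t := s)]
      _ = _ := by
          rw [inner_vec_vec, Finset.mul_sum]
          refine Finset.sum_congr rfl fun i hi => ?_
          rw [Finset.mul_sum]
          exact Finset.sum_congr rfl fun j hj => h2 i hi j hj
  have hbound : ‖∑ A ∈ s.powerset, ∑ F ∈ s.powerset, ⟪vec (E A F) y', T (vec (G A F) x')⟫_ℂ‖ ≤
      ∑ A ∈ s.powerset, ∑ F ∈ s.powerset,
        a * (2 ^ (N + 1) * ‖vec s x‖) * (2 ^ (N + 1) * ‖vec s y‖) := by
    refine norm_sum_le_of_le _ fun A hA => norm_sum_le_of_le _ fun F hF => ?_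
    rw [Finset.mem_powerset] at hA hF
    refine (h _ _ (hoff A hA F hF) x' y').trans ?_
    gcongr
    · exact hvec x _ hCN _ ((Finset.filter_subset _ _).trans hF)
    · exact hvec y _ hRN _ ((Finset.filter_subset _ _).trans hA)
  rw [hsum, norm_mul] at hbound
  simp only [norm_pow, Complex.norm_ofNat, Finset.sum_const, Finset.card_powerset,
    nsmul_eq_mul] at hbound
  push_cast at hbound
  have h4 : (4 : ℝ) ^ (N + 1) = 2 ^ (N + 1) * 2 ^ (N + 1) := by
    rw [← mul_pow]; norm_num
  have hp : (0 : ℝ) < (2 ^ s.card) ^ 2 := by positivity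
  rw [h4]
  refine le_of_mul_le_mul_left (hbound.trans (le_of_eq ?_)) hp
  ring

/-- A pattern all of whose finite pieces are sparse relative to the number of rows and columns
they meet is the union of a row bounded and a column bounded pattern. -/
theorem exists_row_col_decomposition {κ : Set (ℕ × ℕ)} (N : ℕ)
    (h : ∀ Q : Finset (ℕ × ℕ), (∀ p ∈ Q, p ∈ κ) →
      Q.card ≤ N * ((Q.image Prod.fst).card + (Q.image Prod.snd).card)) :
    ∃ κr κc : Set (ℕ × ℕ), κ = κr ∪ κc ∧
      (∀ (i : ℕ) (s : Finset ℕ), (∀ j ∈ s, (i, j) ∈ κr) → s.card ≤ N) ∧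
      (∀ (j : ℕ) (s : Finset ℕ), (∀ i ∈ s, (i, j) ∈ κc) → s.card ≤ N) := by
  let t : κ → Finset ((ℕ ⊕ ℕ) × Fin N) := fun p =>
    ({Sum.inl p.1.1, Sum.inr p.1.2} : Finset (ℕ ⊕ ℕ)) ×ˢ Finset.univ
  obtain ⟨f, hf, hft⟩ := (Finset.all_card_le_biUnion_card_iff_exists_injective t).1 (by
    intro s
    have h1 := h (s.map (Function.Embedding.subtype _)) (by simp +contextual)
    rw [Finset.card_map] at h1
    refine h1.trans ?_
    set Q := s.map (Function.Embedding.subtype (· ∈ κ)) with hQ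
    have hsub : ((Q.image Prod.fst).disjSum (Q.image Prod.snd)) ×ˢ (Finset.univ : Finset (Fin N))
        ⊆ s.biUnion t := by
      rintro ⟨v, k⟩ hv
      rw [Finset.mem_product, Finset.mem_disjSum] at hv
      rcases hv.1 with ⟨i, hi, rfl⟩ | ⟨j, hj, rfl⟩
      · obtain ⟨p, hp, rfl⟩ := Finset.mem_image.1 hi
        obtain ⟨p', hp', rfl⟩ := Finset.mem_map.1 hp
        exact Finset.mem_biUnion.2 ⟨p', hp', by simp [t]⟩
      · obtain ⟨p, hp, rfl⟩ := Finset.mem_image.1 hj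
        obtain ⟨p', hp', rfl⟩ := Finset.mem_map.1 hp
        exact Finset.mem_biUnion.2 ⟨p', hp', by simp [t]⟩
    refine le_trans (le_of_eq ?_) (Finset.card_le_card hsub)
    rw [Finset.card_product, Finset.card_disjSum, Finset.card_univ, Fintype.card_fin, mul_comm])
  have hbound : ∀ (v : ℕ ⊕ ℕ) (s : Finset ℕ) (g : ∀ k ∈ s, κ),
      (∀ k hk l hl, g k hk = g l hl → k = l) → (∀ k hk, (f (g k hk)).1 = v) → s.card ≤ N := by
    intro v s g hg hv
    have := Finset.card_le_card_of_injOn (s := s.attach) (t := (Finset.univ : Finset (Fin N)))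
      (fun k => (f (g k.1 k.2)).2) (by simp) (by
        intro k _ l _ hkl
        exact Subtype.ext (hg _ _ _ _ (hf (Prod.ext ((hv _ _).trans (hv _ _).symm) hkl))))
    simpa using this
  refine ⟨{p | ∃ hp : p ∈ κ, (f ⟨p, hp⟩).1 = Sum.inl p.1},
    {p | ∃ hp : p ∈ κ, (f ⟨p, hp⟩).1 = Sum.inr p.2}, ?_, ?_, ?_⟩
  · ext p
    constructor
    · intro hp
      have := hft ⟨p, hp⟩
      simp only [t, Finset.mem_product, Finset.mem_insert, Finset.mem_singleton] at this
      exact this.1.imp (fun h => ⟨hp, h⟩) fun h => ⟨hp, h⟩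
    · rintro (⟨hp, -⟩ | ⟨hp, -⟩) <;> exact hp
  · intro i s hs
    exact hbound (Sum.inl i) s (fun k hk => ⟨(i, k), (hs k hk).1⟩)
      (fun k _ l _ hkl => by simpa using hkl) fun k hk => (hs k hk).2
  · intro j s hs
    exact hbound (Sum.inr j) s (fun k hk => ⟨(k, j), (hs k hk).1⟩)
      (fun k _ l _ hkl => by simpa using hkl) fun k hk => (hs k hk).2

/-- The bounded transform `W = T* (1 + T T*)⁻¹` of an operator. -/
theorem exists_bounded_transform (T : B ℓ²) :
    ∃ W : B ℓ², ‖W‖ ≤ 1 ∧ ∀ f, W f = star T f - W (T (star T f)) := by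
  have hpos : (0 : B ℓ²) ≤ T * star T := mul_star_self_nonneg T
  have hu : IsUnit (1 + T * star T) := CStarAlgebra.isUnit_of_le 1 (le_add_of_nonneg_right hpos)
  obtain ⟨U, hU⟩ := hu
  refine ⟨star T * (↑U⁻¹ : B ℓ²), ?_, fun f => ?_⟩
  · refine ContinuousLinearMap.opNorm_le_bound _ zero_le_one fun f => ?_
    set y := (↑U⁻¹ : B ℓ²) f with hy
    have hf : f = y + T (star T y) := by
      have h1 : ((U : B ℓ²) * (↑U⁻¹ : B ℓ²)) f = f := by rw [U.mul_inv]; rfl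
      rw [hU] at h1
      exact h1.symm
    change ‖star T y‖ ≤ 1 * ‖f‖
    rw [one_mul]
    refine le_of_sq_le_sq ?_ (norm_nonneg _)
    have h2 : RCLike.re ⟪y, T (star T y)⟫_ℂ = ‖star T y‖ ^ 2 := by
      rw [← ContinuousLinearMap.adjoint_inner_left, ← ContinuousLinearMap.star_eq_adjoint,
        inner_self_eq_norm_sq]
    have h3 := norm_add_sq (𝕜 := ℂ) y (T (star T y))
    rw [← hf, h2] at h3
    nlinarith [sq_nonneg ‖y‖, sq_nonneg ‖T (star T y)‖]
  · have h1 : ((↑U⁻¹ : B ℓ²) * (U : B ℓ²)) f = f := by rw [U.inv_mul]; rfl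
    rw [hU] at h1
    have h2 : (↑U⁻¹ : B ℓ²) (f + T (star T f)) = f := h1
    rw [map_add] at h2
    change star T ((↑U⁻¹ : B ℓ²) f) = star T f - star T ((↑U⁻¹ : B ℓ²) (T (star T f)))
    rw [← map_sub]
    congr 1
    exact eq_sub_of_add_eq h2

/-- The sign pattern attached to a finite set. -/
def sgn (S : Finset (ℕ × ℕ)) (p : ℕ × ℕ) : ℝ := if p ∈ S then -1 else 1

theorem sgn_eq (S : Finset (ℕ × ℕ)) (p : ℕ × ℕ) : sgn S p = 1 ∨ sgn S p = -1 := by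
  unfold sgn; split_ifs <;> simp

theorem sgn_mul_self (S : Finset (ℕ × ℕ)) (p : ℕ × ℕ) : sgn S p * sgn S p = 1 := by
  rcases sgn_eq S p with h | h <;> simp [h]

theorem sgn_symmDiff_self (S : Finset (ℕ × ℕ)) (p : ℕ × ℕ) :
    sgn (symmDiff S {p}) p = - sgn S p := by
  by_cases h : p ∈ S <;> simp [sgn, Finset.mem_symmDiff, h]

theorem sgn_symmDiff_of_ne (S : Finset (ℕ × ℕ)) {p q : ℕ × ℕ} (hq : q ≠ p) :
    sgn (symmDiff S {p}) q = sgn S q := by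
  simp [sgn, Finset.mem_symmDiff, hq]

theorem sum_powerset_eq_zero_of_flip {Q : Finset (ℕ × ℕ)} {p : ℕ × ℕ} (hp : p ∈ Q)
    (F : Finset (ℕ × ℕ) → ℝ) (hF : ∀ S, F (symmDiff S {p}) = - F S) :
    ∑ S ∈ Q.powerset, F S = 0 := by
  have hmem : ∀ S ∈ Q.powerset, symmDiff S {p} ∈ Q.powerset := by
    intro S hS
    rw [Finset.mem_powerset] at hS ⊢
    intro q hq
    rw [Finset.mem_symmDiff, Finset.mem_singleton] at hq
    rcases hq with hq | hq
    · exact hS hq.1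
    · exact hq.1 ▸ hp
  have h : ∑ S ∈ Q.powerset, F S = ∑ S ∈ Q.powerset, - F S :=
    Finset.sum_nbij' (fun S => symmDiff S {p}) (fun S => symmDiff S {p}) hmem hmem
      (fun S _ => symmDiff_symmDiff_cancel_right _ _)
      (fun S _ => symmDiff_symmDiff_cancel_right _ _) fun S _ => by rw [hF, neg_neg]
  rw [Finset.sum_neg_distrib] at h
  linarith

/-- The indicator function of a finite pattern. -/
def ind (Q : Finset (ℕ × ℕ)) (i j : ℕ) : ℝ := if (i, j) ∈ Q then 1 else 0

theorem ind_mul_self (Q : Finset (ℕ × ℕ)) (i j : ℕ) : ind Q i j * ind Q i j = ind Q i j := by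
  unfold ind; split_ifs <;> simp

theorem ind_nonneg (Q : Finset (ℕ × ℕ)) (i j : ℕ) : 0 ≤ ind Q i j := by
  unfold ind; split_ifs <;> simp

theorem sum_eq_sum_ind {M : Type*} [AddCommMonoid M] (Q : Finset (ℕ × ℕ)) (F : ℕ × ℕ → M) :
    ∑ p ∈ Q, F p = ∑ i ∈ Q.image Prod.fst, ∑ j ∈ Q.image Prod.snd,
      if (i, j) ∈ Q then F (i, j) else 0 := by
  rw [← Finset.sum_product', ← Finset.sum_filter]
  refine Finset.sum_congr ?_ fun _ _ => rfl
  ext ⟨i, j⟩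
  simp only [Finset.mem_filter, Finset.mem_product, Finset.mem_image]
  exact ⟨fun h => ⟨⟨⟨_, h, rfl⟩, ⟨_, h, rfl⟩⟩, h⟩, fun h => h.2⟩

theorem card_eq_sum_ind (Q : Finset (ℕ × ℕ)) :
    (Q.card : ℝ) = ∑ i ∈ Q.image Prod.fst, ∑ j ∈ Q.image Prod.snd, ind Q i j := by
  refine Eq.trans ?_ (sum_eq_sum_ind Q fun _ => (1 : ℝ))
  simp

/-- Second moment of the inner product of two distinct random sign rows. -/
theorem sum_sgn_sq_of_ne (Q : Finset (ℕ × ℕ)) (t : Finset ℕ) {i k : ℕ} (hik : i ≠ k) :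
    ∑ S ∈ Q.powerset,
      (∑ j ∈ t, (ind Q i j * sgn S (i, j)) * (ind Q k j * sgn S (k, j))) ^ 2 =
    2 ^ Q.card * ∑ j ∈ t, ind Q i j * ind Q k j := by
  simp_rw [sq, Finset.sum_mul_sum]
  rw [Finset.sum_comm, Finset.mul_sum]
  refine Finset.sum_congr rfl fun j hj => ?_
  rw [Finset.sum_comm, Finset.sum_eq_single_of_mem j hj]
  · have : ∀ S ∈ Q.powerset, (ind Q i j * sgn S (i, j) * (ind Q k j * sgn S (k, j))) *
        (ind Q i j * sgn S (i, j) * (ind Q k j * sgn S (k, j))) = ind Q i j * ind Q k j := by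
      intro S _
      calc _ = (ind Q i j * ind Q i j) * (ind Q k j * ind Q k j) *
            (sgn S (i, j) * sgn S (i, j)) * (sgn S (k, j) * sgn S (k, j)) := by ring
        _ = _ := by rw [sgn_mul_self, sgn_mul_self, ind_mul_self, ind_mul_self, mul_one, mul_one]
    rw [Finset.sum_congr rfl this]
    simp
  · intro l _ hl
    by_cases hp : (i, j) ∈ Q
    · refine sum_powerset_eq_zero_of_flip hp _ fun S => ?_
      rw [sgn_symmDiff_self, sgn_symmDiff_of_ne S (q := (k, j)) (by simp [hik.symm]),
        sgn_symmDiff_of_ne S (q := (i, l)) (by simp [hl]),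
        sgn_symmDiff_of_ne S (q := (k, l)) (by simp [hl])]
      ring
    · exact Finset.sum_eq_zero fun S _ => by simp [ind, hp]

/-- There is a choice of signs for which the weighted Gram matrix of the rows of a pattern is
small in Hilbert-Schmidt norm. -/
theorem exists_signs (Q : Finset (ℕ × ℕ)) (w : ℕ → ℝ) (hw : ∀ i ∈ Q.image Prod.fst, 0 ≤ w i)
    (hrow : ∀ i ∈ Q.image Prod.fst, w i * ∑ j ∈ Q.image Prod.snd, ind Q i j ≤ 1)
    (hcol : ∀ j ∈ Q.image Prod.snd, ∑ i ∈ Q.image Prod.fst, w i * ind Q i j ≤ 1) :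
    ∃ S : Finset (ℕ × ℕ), ∑ i ∈ Q.image Prod.fst, ∑ k ∈ Q.image Prod.fst, w k *
      (∑ j ∈ Q.image Prod.snd, (ind Q i j * sgn S (i, j)) * (ind Q k j * sgn S (k, j))) ^ 2 ≤
      2 * Q.card := by
  set A := Q.image Prod.fst
  set D := Q.image Prod.snd
  suffices h : ∑ S ∈ Q.powerset, ∑ i ∈ A, ∑ k ∈ A, w k *
      (∑ j ∈ D, (ind Q i j * sgn S (i, j)) * (ind Q k j * sgn S (k, j))) ^ 2 ≤
      ∑ S ∈ Q.powerset, 2 * (Q.card : ℝ) by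
    obtain ⟨S, -, hS⟩ := Finset.exists_le_of_sum_le (Finset.powerset_nonempty _) h
    exact ⟨S, hS⟩
  rw [Finset.sum_const, Finset.card_powerset, nsmul_eq_mul]
  simp_rw [Finset.sum_comm (s := Q.powerset), ← Finset.mul_sum (s := Q.powerset)]
  have h1 : ∀ i ∈ A, ∀ k ∈ A, w k * ∑ S ∈ Q.powerset,
      (∑ j ∈ D, (ind Q i j * sgn S (i, j)) * (ind Q k j * sgn S (k, j))) ^ 2 ≤
      2 ^ Q.card * ((if i = k then w k * (∑ j ∈ D, ind Q i j) ^ 2 else 0) +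
        ∑ j ∈ D, ind Q i j * (w k * ind Q k j)) := by
    intro i hi k hk
    have hnn : 0 ≤ ∑ j ∈ D, ind Q i j * (w k * ind Q k j) :=
      Finset.sum_nonneg fun j _ => mul_nonneg (ind_nonneg _ _ _)
        (mul_nonneg (hw k hk) (ind_nonneg _ _ _))
    by_cases hik : i = k
    · subst hik
      have : ∀ S ∈ Q.powerset, (∑ j ∈ D, (ind Q i j * sgn S (i, j)) *
          (ind Q i j * sgn S (i, j))) ^ 2 = (∑ j ∈ D, ind Q i j) ^ 2 := by
        intro S _
        congr 1
        refine Finset.sum_congr rfl fun j _ => ?_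
        rw [mul_mul_mul_comm, sgn_mul_self, ind_mul_self, mul_one]
      rw [Finset.sum_congr rfl this, Finset.sum_const, Finset.card_powerset, nsmul_eq_mul,
        if_pos rfl]
      push_cast
      have h2 : (0 : ℝ) ≤ 2 ^ Q.card * ∑ j ∈ D, ind Q i j * (w i * ind Q i j) := by positivity
      linarith
    · rw [sum_sgn_sq_of_ne Q D hik, if_neg hik, zero_add]
      refine le_of_eq ?_
      rw [mul_left_comm, Finset.mul_sum (a := w k)]
      congr 1
      exact Finset.sum_congr rfl fun j _ => by ring
  refine (Finset.sum_le_sum fun i hi => Finset.sum_le_sum fun k hk => h1 i hi k hk).trans ?_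
  simp_rw [← Finset.mul_sum]
  push_cast
  refine mul_le_mul_of_nonneg_left ?_ (by positivity)
  simp_rw [Finset.sum_add_distrib]
  rw [two_mul]
  refine add_le_add ?_ ?_
  · rw [card_eq_sum_ind]
    refine Finset.sum_le_sum fun i hi => ?_
    rw [Finset.sum_ite_eq, if_pos hi, sq, ← mul_assoc]
    exact mul_le_of_le_one_left (Finset.sum_nonneg fun j _ => ind_nonneg _ _ _) (hrow i hi)
  · rw [card_eq_sum_ind]
    refine Finset.sum_le_sum fun i _ => ?_
    rw [Finset.sum_comm]
    refine Finset.sum_le_sum fun j hj => ?_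
    rw [← Finset.mul_sum]
    exact mul_le_of_le_one_right (ind_nonneg _ _ _) (hcol j hj)

/-- Schur multiplication by functions of modulus at most one, supported on finite subsets of `κ`,
is bounded by `C`. -/
def SchurBoundedBy (κ : Set (ℕ × ℕ)) (C : ℝ) : Prop :=
  ∀ Q : Finset (ℕ × ℕ), (∀ p ∈ Q, p ∈ κ) → ∀ φ : ℕ × ℕ → ℂ, (∀ p, ‖φ p‖ ≤ 1) →
    ∀ (Z : B ℓ²) (u v : ℕ → ℂ),
      ‖∑ p ∈ Q, starRingEnd ℂ (u p.1) * v p.2 * φ p * ⟪e p.1, Z (e p.2)⟫_ℂ‖ ≤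
        C * ‖Z‖ * ‖vec (Q.image Prod.fst) u‖ * ‖vec (Q.image Prod.snd) v‖

theorem image_fst_image_swap (Q : Finset (ℕ × ℕ)) :
    (Q.image Prod.swap).image Prod.fst = Q.image Prod.snd := by
  rw [Finset.image_image]; rfl

theorem image_snd_image_swap (Q : Finset (ℕ × ℕ)) :
    (Q.image Prod.swap).image Prod.snd = Q.image Prod.fst := by
  rw [Finset.image_image]; rfl

theorem SchurBoundedBy.swap {κ : Set (ℕ × ℕ)} {C : ℝ} (h : SchurBoundedBy κ C) :
    SchurBoundedBy (Prod.swap ⁻¹' κ) C := by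
  intro Q hQ φ hφ Z u v
  have h1 := h (Q.image Prod.swap)
    (by intro p hp; obtain ⟨q, hq, rfl⟩ := Finset.mem_image.1 hp; exact hQ q hq)
    (fun p => starRingEnd ℂ (φ p.swap)) (fun p => by rw [RCLike.norm_conj]; exact hφ _)
    (star Z) v u
  rw [image_fst_image_swap, image_snd_image_swap, norm_star,
    Finset.sum_image Prod.swap_injective.injOn] at h1
  have h2 : ∑ p ∈ Q, starRingEnd ℂ (u p.1) * v p.2 * φ p * ⟪e p.1, Z (e p.2)⟫_ℂ =
      starRingEnd ℂ (∑ p ∈ Q, starRingEnd ℂ (v p.swap.1) * u p.swap.2 *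
        starRingEnd ℂ (φ p.swap.swap) * ⟪e p.swap.1, star Z (e p.swap.2)⟫_ℂ) := by
    rw [map_sum]
    refine Finset.sum_congr rfl fun p _ => ?_
    simp only [map_mul, Complex.conj_conj, inner_conj_symm, Prod.fst_swap, Prod.snd_swap,
      Prod.swap_swap, ContinuousLinearMap.star_eq_adjoint, ContinuousLinearMap.adjoint_inner_left]
    ring
  rw [h2, RCLike.norm_conj]
  exact h1.trans (le_of_eq (by ring))

/-- The operator with rows `t i`, `i ∈ A`, and zero otherwise. -/
def rowOp (A : Finset ℕ) (t : ℕ → ℓ²) : B ℓ² :=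
  ∑ i ∈ A, InnerProductSpace.rankOne ℂ (e i) (t i)

theorem rowOp_apply (A : Finset ℕ) (t : ℕ → ℓ²) (f : ℓ²) :
    rowOp A t f = vec A fun i => ⟪t i, f⟫_ℂ := by
  simp [rowOp, vec]

theorem star_rowOp_e {A : Finset ℕ} {i : ℕ} (hi : i ∈ A) (t : ℕ → ℓ²) :
    star (rowOp A t) (e i) = t i := by
  refine ext_inner_right ℂ fun f => ?_
  rw [ContinuousLinearMap.star_eq_adjoint, ContinuousLinearMap.adjoint_inner_left, rowOp_apply,
    vec, inner_sum, Finset.sum_eq_single_of_mem i hi]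
  · rw [inner_smul_right, inner_e_e, if_pos rfl, mul_one]
  · intro k _ hk
    rw [inner_smul_right, inner_e_e, if_neg hk.symm, mul_zero]

/-- A contraction that correlates with given rows whose Gram matrix is not too large. -/
theorem exists_contraction (A : Finset ℕ) (t : ℕ → ℓ²) :
    ∃ W : B ℓ², ‖W‖ ≤ 1 ∧ ∀ i ∈ A, 5 / 18 * ‖t i‖ ^ 2 - 1 / 18 * ∑ k ∈ A, ‖⟪t k, t i⟫_ℂ‖ ^ 2 ≤
      RCLike.re ⟪W (e i), t i⟫_ℂ := by
  obtain ⟨W, hW, hWe⟩ := exists_bounded_transform (rowOp A fun i => ((1 / 3 : ℝ) : ℂ) • t i)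
  refine ⟨W, hW, fun i hi => ?_⟩
  rw [hWe, star_rowOp_e hi, rowOp_apply, inner_sub_left, map_sub, inner_smul_left]
  set s := vec A fun k => ⟪((1 / 3 : ℝ) : ℂ) • t k, ((1 / 3 : ℝ) : ℂ) • t i⟫_ℂ with hs
  have h1 : ‖s‖ ^ 2 = 1 / 81 * ∑ k ∈ A, ‖⟪t k, t i⟫_ℂ‖ ^ 2 := by
    rw [hs, norm_vec_sq, Finset.mul_sum]
    refine Finset.sum_congr rfl fun k _ => ?_
    rw [inner_smul_left, inner_smul_right, Complex.conj_ofReal, norm_mul, norm_mul,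
      Complex.norm_real, Real.norm_of_nonneg (by norm_num)]
    ring
  have h2 : RCLike.re ⟪W s, t i⟫_ℂ ≤ ‖s‖ * ‖t i‖ := by
    refine (re_inner_le_norm _ _).trans (mul_le_mul_of_nonneg_right ?_ (norm_nonneg _))
    exact (W.le_opNorm s).trans (mul_le_of_le_one_left (norm_nonneg _) hW)
  have h3 : RCLike.re (starRingEnd ℂ ((1 / 3 : ℝ) : ℂ) * ⟪t i, t i⟫_ℂ) = 1 / 3 * ‖t i‖ ^ 2 := by
    rw [Complex.conj_ofReal, inner_self_eq_norm_sq_to_K]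
    simp only [Complex.coe_algebraMap, ← Complex.ofReal_pow, ← Complex.ofReal_mul]
    exact Complex.ofReal_re _
  rw [h3]
  nlinarith [sq_nonneg (3 * ‖s‖ - 1 / 3 * ‖t i‖)]

theorem SchurBoundedBy.card_le {κ : Set (ℕ × ℕ)} {C : ℝ} (hC : 0 ≤ C) (h : SchurBoundedBy κ C)
    (Q : Finset (ℕ × ℕ)) (hQ : ∀ p ∈ Q, p ∈ κ) (r : ℕ → ℝ)
    (hr : ∀ i ∈ Q.image Prod.fst, 0 < r i)
    (hrow : ∀ i ∈ Q.image Prod.fst, ∑ j ∈ Q.image Prod.snd, ind Q i j ≤ r i)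
    (hcol : ∀ p ∈ Q, ∑ i ∈ Q.image Prod.fst, ind Q i p.2 ≤ r p.1) :
    (Q.card : ℝ) ≤ 6 * C * √(∑ i ∈ Q.image Prod.fst, r i) * √((Q.image Prod.snd).card) := by
  have hmem : ∀ p ∈ Q, p.1 ∈ Q.image Prod.fst := fun p hp => Finset.mem_image_of_mem _ hp
  obtain ⟨S, hS⟩ := exists_signs Q (fun i => (r i)⁻¹) (fun i hi => (inv_pos.2 (hr i hi)).le)
    (fun i hi => by
      rw [inv_mul_eq_div, div_le_one (hr i hi)]; exact hrow i hi)
    (fun j hj => by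
      set d := ∑ i ∈ Q.image Prod.fst, ind Q i j with hd
      have hdpos : 0 < d := by
        obtain ⟨p, hp, rfl⟩ := Finset.mem_image.1 hj
        refine Finset.sum_pos' (fun _ _ => ind_nonneg _ _ _) ⟨p.1, hmem p hp, ?_⟩
        simp [ind, hp]
      calc ∑ i ∈ Q.image Prod.fst, (r i)⁻¹ * ind Q i j
          ≤ ∑ i ∈ Q.image Prod.fst, d⁻¹ * ind Q i j := by
            refine Finset.sum_le_sum fun i hi => ?_
            by_cases hij : (i, j) ∈ Q
            · exact mul_le_mul_of_nonneg_right (inv_anti₀ hdpos (hcol _ hij)) (ind_nonneg _ _ _)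
            · simp [ind, hij]
        _ = 1 := by rw [← Finset.mul_sum, inv_mul_cancel₀ hdpos.ne'])
  set A := Q.image Prod.fst with hA
  set D := Q.image Prod.snd with hD
  set t : ℕ → ℓ² := fun i => vec D fun j => ((ind Q i j * sgn S (i, j) * (√(r i))⁻¹ : ℝ) : ℂ)
    with ht
  have hinner : ∀ k i, ⟪t k, t i⟫_ℂ = (((√(r k))⁻¹ * (√(r i))⁻¹ *
      ∑ j ∈ D, (ind Q i j * sgn S (i, j)) * (ind Q k j * sgn S (k, j)) : ℝ) : ℂ) := by
    intro k i
    have h1 := orthonormal_e.inner_sum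
      (fun j => ((ind Q k j * sgn S (k, j) * (√(r k))⁻¹ : ℝ) : ℂ))
      (fun j => ((ind Q i j * sgn S (i, j) * (√(r i))⁻¹ : ℝ) : ℂ)) D
    refine h1.trans ?_
    simp_rw [Complex.conj_ofReal]
    rw [Finset.mul_sum]
    push_cast
    exact Finset.sum_congr rfl fun j _ => by ring
  have hnorm : ∀ i ∈ A, r i * ‖t i‖ ^ 2 = ∑ j ∈ D, ind Q i j := by
    intro i hi
    rw [ht, norm_vec_sq, Finset.mul_sum]
    refine Finset.sum_congr rfl fun j _ => ?_
    rw [Complex.norm_real, Real.norm_eq_abs, sq_abs, mul_pow, inv_pow, Real.sq_sqrt (hr i hi).le,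
      mul_pow, sq, sq, sgn_mul_self, ind_mul_self]
    field_simp [(hr i hi).ne']
  have hgram : ∑ i ∈ A, r i * ∑ k ∈ A, ‖⟪t k, t i⟫_ℂ‖ ^ 2 ≤ 2 * Q.card := by
    refine le_trans (le_of_eq ?_) hS
    refine Finset.sum_congr rfl fun i hi => ?_
    rw [Finset.mul_sum]
    refine Finset.sum_congr rfl fun k hk => ?_
    rw [hinner, Complex.norm_real, Real.norm_eq_abs, sq_abs, mul_pow, mul_pow, inv_pow, inv_pow,
      Real.sq_sqrt (hr i hi).le, Real.sq_sqrt (hr k hk).le]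
    field_simp [(hr i hi).ne']
  obtain ⟨W, hW, hWt⟩ := exists_contraction A t
  have hlow : 1 / 6 * (Q.card : ℝ) ≤ ∑ i ∈ A, r i * RCLike.re ⟪W (e i), t i⟫_ℂ := by
    have h1 : ∑ i ∈ A, r i * (5 / 18 * ‖t i‖ ^ 2 - 1 / 18 * ∑ k ∈ A, ‖⟪t k, t i⟫_ℂ‖ ^ 2) ≤
        ∑ i ∈ A, r i * RCLike.re ⟪W (e i), t i⟫_ℂ :=
      Finset.sum_le_sum fun i hi => mul_le_mul_of_nonneg_left (hWt i hi) (hr i hi).le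
    have h2 : ∑ i ∈ A, r i * (5 / 18 * ‖t i‖ ^ 2 - 1 / 18 * ∑ k ∈ A, ‖⟪t k, t i⟫_ℂ‖ ^ 2) =
        5 / 18 * ∑ i ∈ A, r i * ‖t i‖ ^ 2 -
          1 / 18 * ∑ i ∈ A, r i * ∑ k ∈ A, ‖⟪t k, t i⟫_ℂ‖ ^ 2 := by
      rw [Finset.mul_sum, Finset.mul_sum, ← Finset.sum_sub_distrib]
      exact Finset.sum_congr rfl fun i _ => by ring
    rw [h2, Finset.sum_congr rfl hnorm, ← card_eq_sum_ind] at h1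
    linarith
  have hup := h Q hQ (fun p => (sgn S p : ℂ))
    (fun p => by rcases sgn_eq S p with h | h <;> simp [h]) (star W)
    (fun i => (√(r i) : ℂ)) (fun _ => 1)
  have hsum : ∑ p ∈ Q, starRingEnd ℂ (√(r p.1) : ℂ) * 1 * (sgn S p : ℂ) *
      ⟪e p.1, star W (e p.2)⟫_ℂ = ∑ i ∈ A, (r i : ℂ) * ⟪W (e i), t i⟫_ℂ := by
    rw [sum_eq_sum_ind]
    refine Finset.sum_congr rfl fun i hi => ?_
    simp only [ht, vec, inner_sum, Finset.mul_sum]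
    refine Finset.sum_congr rfl fun j _ => ?_
    rw [inner_smul_right, ContinuousLinearMap.star_eq_adjoint,
      ContinuousLinearMap.adjoint_inner_right, Complex.conj_ofReal]
    have hsq : (r i : ℂ) * ((√(r i))⁻¹ : ℝ) = (√(r i) : ℝ) := by
      rw [← Complex.ofReal_mul, ← div_eq_mul_inv, Real.div_sqrt]
    by_cases hij : (i, j) ∈ Q
    · rw [if_pos hij]
      simp only [ind, if_pos hij]
      rw [← hsq]
      push_cast
      ring
    · simp [ind, hij]
  rw [hsum, norm_star] at hup
  have hre : ∑ i ∈ A, r i * RCLike.re ⟪W (e i), t i⟫_ℂ ≤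
      ‖∑ i ∈ A, (r i : ℂ) * ⟪W (e i), t i⟫_ℂ‖ := by
    refine le_trans (le_of_eq ?_) (Complex.re_le_norm _)
    rw [Complex.re_sum]
    exact Finset.sum_congr rfl fun i _ => (Complex.re_ofReal_mul _ _).symm
  have hu : ‖vec A fun i => (√(r i) : ℂ)‖ = √(∑ i ∈ A, r i) := by
    rw [norm_vec]
    congr 1
    refine Finset.sum_congr rfl fun i hi => ?_
    rw [Complex.norm_real, Real.norm_eq_abs, sq_abs, Real.sq_sqrt (hr i hi).le]
  have hv : ‖vec D fun _ => 1‖ = √(D.card) := by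
    rw [norm_vec]; simp
  rw [hu, hv] at hup
  have hW' : C * ‖W‖ * √(∑ i ∈ A, r i) * √(D.card) ≤ C * 1 * √(∑ i ∈ A, r i) * √(D.card) := by
    gcongr
  linarith

theorem ind_mono {Q Q' : Finset (ℕ × ℕ)} (h : Q' ⊆ Q) (i j : ℕ) : ind Q' i j ≤ ind Q i j := by
  unfold ind
  split_ifs with h1 h2
  · exact le_rfl
  · exact absurd (h h1) h2
  · exact zero_le_one
  · exact le_rfl

/-- Removing a row from a pattern removes as many entries as there are in that row. -/
theorem card_filter_fst_ne (Q : Finset (ℕ × ℕ)) {i : ℕ} (hi : i ∈ Q.image Prod.fst) :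
    ((Q.filter fun p => p.1 ≠ i).card : ℝ) + ∑ j ∈ Q.image Prod.snd, ind Q i j = Q.card := by
  have h1 : (Q.card : ℝ) = ∑ p ∈ Q, (if p.1 ≠ i then 1 else 0) + ∑ p ∈ Q,
      (if p.1 = i then (1 : ℝ) else 0) := by
    rw [← Finset.sum_add_distrib, Finset.card_eq_sum_ones, Nat.cast_sum]
    refine Finset.sum_congr rfl fun p _ => ?_
    by_cases h : p.1 = i <;> simp [h]
  rw [h1, Finset.sum_boole, sum_eq_sum_ind Q fun p => if p.1 = i then (1 : ℝ) else 0]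
  congr 1
  rw [Finset.sum_eq_single_of_mem i hi]
  · exact Finset.sum_congr rfl fun j _ => by simp [ind]
  · intro k _ hk
    exact Finset.sum_eq_zero fun j _ => by simp [hk]

theorem ind_image_swap (Q : Finset (ℕ × ℕ)) (i j : ℕ) : ind (Q.image Prod.swap) i j = ind Q j i := by
  have : (i, j) ∈ Q.image Prod.swap ↔ (j, i) ∈ Q := by
    simp [Finset.mem_image, Prod.swap]
  simp [ind, this]

/-- The rows of a minimal dense pattern are long. -/
theorem lt_row_of_minimal (N : ℕ) (Q : Finset (ℕ × ℕ))
    (hQ : N * ((Q.image Prod.fst).card + (Q.image Prod.snd).card) < Q.card)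
    (hmin : ∀ Q' ⊂ Q, Q'.card ≤ N * ((Q'.image Prod.fst).card + (Q'.image Prod.snd).card))
    {i : ℕ} (hi : i ∈ Q.image Prod.fst) : (N : ℝ) < ∑ j ∈ Q.image Prod.snd, ind Q i j := by
  have h1 := card_filter_fst_ne Q hi
  have hss : (Q.filter fun p => p.1 ≠ i) ⊂ Q := by
    obtain ⟨p, hp, rfl⟩ := Finset.mem_image.1 hi
    exact Finset.filter_ssubset.2 ⟨p, hp, by simp⟩
  have h2 := hmin _ hss
  have h3 : (((Q.filter fun p => p.1 ≠ i).image Prod.fst).card) + 1 ≤ (Q.image Prod.fst).card := by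
    rw [← Finset.card_erase_add_one hi]
    refine Nat.add_le_add_right (Finset.card_le_card fun k hk => ?_) 1
    obtain ⟨p, hp, rfl⟩ := Finset.mem_image.1 hk
    rw [Finset.mem_filter] at hp
    exact Finset.mem_erase.2 ⟨hp.2, Finset.mem_image_of_mem _ hp.1⟩
  have h4 : ((Q.filter fun p => p.1 ≠ i).image Prod.snd).card ≤ (Q.image Prod.snd).card :=
    Finset.card_le_card (Finset.image_subset_image (Finset.filter_subset _ _))
  have h5 : (Q.filter fun p => p.1 ≠ i).card + N < Q.card := by nlinarith
  have h6 : ((Q.filter fun p => p.1 ≠ i).card : ℝ) + N < Q.card := by exact_mod_cast h5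
  linarith

theorem SchurBoundedBy.card_sq_le {κ : Set (ℕ × ℕ)} {C : ℝ} (hC : 0 ≤ C)
    (h : SchurBoundedBy κ C) {Q Q' : Finset (ℕ × ℕ)} (hQ : ∀ p ∈ Q, p ∈ κ) (hQ' : Q' ⊆ Q)
    (hcol : ∀ p ∈ Q', ∑ i ∈ Q.image Prod.fst, ind Q i p.2 ≤ ∑ j ∈ Q.image Prod.snd, ind Q p.1 j) :
    (Q'.card : ℝ) ^ 2 ≤ 36 * C ^ 2 * Q.card * (Q.image Prod.snd).card := by
  have hA : Q'.image Prod.fst ⊆ Q.image Prod.fst := Finset.image_subset_image hQ'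
  have hD : Q'.image Prod.snd ⊆ Q.image Prod.snd := Finset.image_subset_image hQ'
  have h1 := h.card_le hC Q' (fun p hp => hQ p (hQ' hp))
    (fun i => ∑ j ∈ Q.image Prod.snd, ind Q i j)
    (fun i hi => by
      obtain ⟨p, hp, rfl⟩ := Finset.mem_image.1 (hA hi)
      refine Finset.sum_pos' (fun _ _ => ind_nonneg _ _ _)
        ⟨p.2, Finset.mem_image_of_mem _ hp, ?_⟩
      simp [ind, hp])
    (fun i _ => (Finset.sum_le_sum fun j _ => ind_mono hQ' i j).trans
      (Finset.sum_le_sum_of_subset_of_nonneg hD fun _ _ _ => ind_nonneg _ _ _))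
    (fun p hp => ((Finset.sum_le_sum fun i _ => ind_mono hQ' i p.2).trans
      (Finset.sum_le_sum_of_subset_of_nonneg hA fun _ _ _ => ind_nonneg _ _ _)).trans (hcol p hp))
  have h2 : ∑ i ∈ Q'.image Prod.fst, ∑ j ∈ Q.image Prod.snd, ind Q i j ≤ Q.card := by
    rw [card_eq_sum_ind Q]
    exact Finset.sum_le_sum_of_subset_of_nonneg hA fun _ _ _ =>
      Finset.sum_nonneg fun _ _ => ind_nonneg _ _ _
  have h3 : ((Q'.image Prod.snd).card : ℝ) ≤ (Q.image Prod.snd).card := by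
    exact_mod_cast Finset.card_le_card hD
  have h4 : (Q'.card : ℝ) ≤ 6 * C * √(Q.card) * √((Q.image Prod.snd).card) :=
    h1.trans (by gcongr)
  calc (Q'.card : ℝ) ^ 2 ≤ (6 * C * √(Q.card) * √((Q.image Prod.snd).card)) ^ 2 := by gcongr
    _ = _ := by
      rw [mul_pow, mul_pow, mul_pow, Real.sq_sqrt (by positivity), Real.sq_sqrt (by positivity)]
      ring

/-- Finite pieces of a Schur bounded pattern are sparse. -/
theorem SchurBoundedBy.card_le_mul {κ : Set (ℕ × ℕ)} {C : ℝ} (hC : 0 ≤ C)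
    (h : SchurBoundedBy κ C) {N : ℕ} (hN : 144 * C ^ 2 < N) (Q : Finset (ℕ × ℕ))
    (hQ : ∀ p ∈ Q, p ∈ κ) : Q.card ≤ N * ((Q.image Prod.fst).card + (Q.image Prod.snd).card) := by
  induction Q using Finset.strongInduction with
  | H Q ih =>
    by_contra! hlt
    have hmin : ∀ Q' ⊂ Q, Q'.card ≤ N * ((Q'.image Prod.fst).card + (Q'.image Prod.snd).card) :=
      fun Q' hQ' => ih Q' hQ' fun p hp => hQ p (hQ'.1 hp)
    have hcardswap : ∀ P : Finset (ℕ × ℕ), (P.image Prod.swap).card = P.card := fun P =>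
      Finset.card_image_of_injective _ Prod.swap_injective
    have hswapswap : ∀ P : Finset (ℕ × ℕ), (P.image Prod.swap).image Prod.swap = P := fun P => by
      rw [Finset.image_image, Prod.swap_swap_eq, Finset.image_id]
    have hrow : ∀ i ∈ Q.image Prod.fst, (N : ℝ) ≤ ∑ j ∈ Q.image Prod.snd, ind Q i j :=
      fun i hi => (lt_row_of_minimal N Q hlt hmin hi).le
    have hcol : ∀ j ∈ Q.image Prod.snd, (N : ℝ) ≤ ∑ i ∈ Q.image Prod.fst, ind Q i j := by
      intro j hj
      have h1 := lt_row_of_minimal N (Q.image Prod.swap) (i := j)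
        (by rw [image_fst_image_swap, image_snd_image_swap, hcardswap]; lia)
        (by
          intro Q' hQ'
          have h2 := hmin (Q'.image Prod.swap) (by
            have := (Finset.image_ssubset_image Prod.swap_injective).2 hQ'
            rwa [hswapswap] at this)
          rw [image_fst_image_swap, image_snd_image_swap, hcardswap] at h2
          lia)
        (by rwa [image_fst_image_swap])
      rw [image_snd_image_swap] at h1
      simp_rw [ind_image_swap] at h1
      exact h1.le
    have hNA : (N : ℝ) * (Q.image Prod.fst).card ≤ Q.card := by
      rw [card_eq_sum_ind, mul_comm, ← nsmul_eq_mul]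
      exact Finset.card_nsmul_le_sum _ _ _ hrow
    have hND : (N : ℝ) * (Q.image Prod.snd).card ≤ Q.card := by
      rw [card_eq_sum_ind, Finset.sum_comm, mul_comm, ← nsmul_eq_mul]
      exact Finset.card_nsmul_le_sum _ _ _ hcol
    set P : ℕ × ℕ → Prop := fun p =>
      ∑ i ∈ Q.image Prod.fst, ind Q i p.2 ≤ ∑ j ∈ Q.image Prod.snd, ind Q p.1 j with hP
    classical
    have h1 := h.card_sq_le hC hQ (Finset.filter_subset P Q) fun p hp => (Finset.mem_filter.1 hp).2
    have h2 := h.swap.card_sq_le hC (Q := Q.image Prod.swap)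
      (Q' := (Q.filter fun p => ¬ P p).image Prod.swap)
      (by
        intro p hp
        obtain ⟨q, hq, rfl⟩ := Finset.mem_image.1 hp
        exact hQ q hq)
      (Finset.image_subset_image (Finset.filter_subset _ _))
      (by
        intro p hp
        obtain ⟨q, hq, rfl⟩ := Finset.mem_image.1 hp
        rw [image_fst_image_swap, image_snd_image_swap]
        simp_rw [ind_image_swap]
        exact (not_le.1 (Finset.mem_filter.1 hq).2).le)
    rw [image_snd_image_swap, hcardswap, hcardswap] at h2
    have h3 : ((Q.filter P).card : ℝ) + (Q.filter fun p => ¬ P p).card = Q.card := by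
      exact_mod_cast Finset.card_filter_add_card_filter_not P
    have hq : (0 : ℝ) < Q.card := by exact_mod_cast (Nat.zero_le _).trans_lt hlt
    have hNpos : (0 : ℝ) < N := lt_of_le_of_lt (by positivity) hN
    set q : ℝ := (Q.card : ℝ)
    have h4 : N * ((Q.filter P).card : ℝ) ^ 2 ≤ 36 * C ^ 2 * q * q := by
      have : 36 * C ^ 2 * q * (N * (Q.image Prod.snd).card) ≤ 36 * C ^ 2 * q * q := by gcongr
      nlinarith
    have h5 : N * ((Q.filter fun p => ¬ P p).card : ℝ) ^ 2 ≤ 36 * C ^ 2 * q * q := by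
      have : 36 * C ^ 2 * q * (N * (Q.image Prod.fst).card) ≤ 36 * C ^ 2 * q * q := by gcongr
      nlinarith
    set a : ℝ := ((Q.filter P).card : ℝ)
    set b : ℝ := ((Q.filter fun p => ¬ P p).card : ℝ)
    have h6 : q ^ 2 ≤ 2 * (a ^ 2 + b ^ 2) := by
      rw [← h3]; nlinarith [sq_nonneg (a - b)]
    have h7 : N * q ^ 2 ≤ 144 * C ^ 2 * q ^ 2 := by nlinarith
    have h8 : 144 * C ^ 2 * q ^ 2 < N * q ^ 2 := by gcongr
    linarith

/-- Uniform boundedness of the Schur multipliers supported on a Schur bounded pattern. -/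
theorem exists_schurBoundedBy (κ : Set (ℕ × ℕ))
    (hκ : ∀ φ : ℕ × ℕ → ℂ, (∃ M : ℝ, ∀ p, ‖φ p‖ ≤ M) → (∀ p ∉ κ, φ p = 0) →
      ∃ Φ : B ℓ² →L[ℂ] B ℓ², ∀ (T : B ℓ²) (i j : ℕ),
          ⟪e i, Φ T (e j)⟫_ℂ = φ (i, j) * ⟪e i, T (e j)⟫_ℂ) :
    ∃ C : ℝ, 0 ≤ C ∧ SchurBoundedBy κ C := by
  classical
  let ext0 : lp (fun _ : κ => ℂ) ⊤ → ℕ × ℕ → ℂ := fun a p => if h : p ∈ κ then a ⟨p, h⟩ else 0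
  have hext : ∀ a, ∃ Φ : B ℓ² →L[ℂ] B ℓ², ∀ (T : B ℓ²) (i j : ℕ),
      ⟪e i, Φ T (e j)⟫_ℂ = ext0 a (i, j) * ⟪e i, T (e j)⟫_ℂ := by
    intro a
    refine hκ _ ⟨‖a‖, fun p => ?_⟩ fun p hp => by simp [ext0, hp]
    by_cases hp : p ∈ κ
    · simpa [ext0, hp] using lp.norm_apply_le_norm ENNReal.top_ne_zero a ⟨p, hp⟩
    · simp [ext0, hp]
  choose Ψ hΨ using hext
  let g : lp (fun _ : κ => ℂ) ⊤ →ₗ[ℂ] (B ℓ² →L[ℂ] B ℓ²) :=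
    { toFun := Ψ
      map_add' := by
        intro a b
        refine ContinuousLinearMap.ext fun T => ext_entries fun i j => ?_
        rw [add_apply, add_apply, inner_add_right,
          hΨ, hΨ, hΨ, ← add_mul]
        congr 1
        by_cases hp : (i, j) ∈ κ <;> simp [ext0, hp]
      map_smul' := by
        intro c a
        refine ContinuousLinearMap.ext fun T => ext_entries fun i j => ?_
        rw [RingHom.id_apply, smul_apply, smul_apply,
          inner_smul_right, hΨ, hΨ, ← mul_assoc]
        congr 1
        by_cases hp : (i, j) ∈ κ <;> simp [ext0, hp] }
  have hentry : ∀ (T : B ℓ²) (i j : ℕ),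
      Continuous fun F : B ℓ² →L[ℂ] B ℓ² => ⟪e i, F T (e j)⟫_ℂ := by
    intro T i j
    fun_prop
  have hg : Continuous g := by
    refine g.continuous_of_seq_closed_graph fun a x F ha hF => ?_
    refine ContinuousLinearMap.ext fun T => ext_entries fun i j => ?_
    have h1 := ((hentry T i j).tendsto F).comp hF
    have h2 : Filter.Tendsto (fun n => ext0 (a n) (i, j) * ⟪e i, T (e j)⟫_ℂ) Filter.atTop
        (nhds (ext0 x (i, j) * ⟪e i, T (e j)⟫_ℂ)) := by
      refine Filter.Tendsto.mul_const _ ?_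
      by_cases hp : (i, j) ∈ κ
      · simp only [ext0, hp, dif_pos]
        rw [tendsto_iff_norm_sub_tendsto_zero] at ha ⊢
        refine squeeze_zero (fun _ => norm_nonneg _) (fun n => ?_) ha
        exact lp.norm_apply_le_norm ENNReal.top_ne_zero (a n - x) ⟨(i, j), hp⟩
      · simp [ext0, hp]
    have h3 : (fun F : B ℓ² →L[ℂ] B ℓ² => ⟪e i, F T (e j)⟫_ℂ) ∘ g ∘ a =
        fun n => ext0 (a n) (i, j) * ⟪e i, T (e j)⟫_ℂ := funext fun n => hΨ (a n) T i j
    rw [h3] at h1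
    exact (tendsto_nhds_unique h1 h2).trans (hΨ x T i j).symm
  let G : lp (fun _ : κ => ℂ) ⊤ →L[ℂ] (B ℓ² →L[ℂ] B ℓ²) := ⟨g, hg⟩
  refine ⟨‖G‖, norm_nonneg G, fun Q hQ φ hφ Z u v => ?_⟩
  let b : κ → ℂ := fun p => if p.1 ∈ Q then φ p.1 else 0
  have hb : ∀ p, ‖b p‖ ≤ 1 := by
    intro p
    by_cases hp : p.1 ∈ Q
    · simpa [b, hp] using hφ p.1
    · simp [b, hp]
  let a : lp (fun _ : κ => ℂ) ⊤ := ⟨b, memℓp_infty ⟨1, by rintro _ ⟨p, rfl⟩; exact hb p⟩⟩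
  have ha : ‖a‖ ≤ 1 := lp.norm_le_of_forall_le zero_le_one hb
  have hsum : ∑ p ∈ Q, starRingEnd ℂ (u p.1) * v p.2 * φ p * ⟪e p.1, Z (e p.2)⟫_ℂ =
      ⟪vec (Q.image Prod.fst) u, G a Z (vec (Q.image Prod.snd) v)⟫_ℂ := by
    rw [inner_vec_vec, sum_eq_sum_ind]
    refine Finset.sum_congr rfl fun i _ => Finset.sum_congr rfl fun j _ => ?_
    have h1 : ⟪e i, G a Z (e j)⟫_ℂ = ext0 a (i, j) * ⟪e i, Z (e j)⟫_ℂ := hΨ a Z i j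
    have h2 : ext0 a (i, j) = if (i, j) ∈ Q then φ (i, j) else 0 := by
      by_cases hp : (i, j) ∈ κ
      · simp only [ext0, hp, dif_pos]
        rfl
      · have : (i, j) ∉ Q := fun h => hp (hQ _ h)
        simp [ext0, hp, this]
    rw [h1, h2]
    split_ifs
    · ring
    · ring
  rw [hsum]
  refine (norm_inner_le_norm _ _).trans ?_
  have h1 : ‖G a Z‖ ≤ ‖G‖ * ‖Z‖ := by
    refine ((G a).le_opNorm Z).trans ?_
    refine mul_le_mul_of_nonneg_right ?_ (norm_nonneg _)
    exact (G.le_opNorm a).trans (mul_le_of_le_one_right (norm_nonneg _) ha)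
  have h2 := ((G a Z).le_opNorm (vec (Q.image Prod.snd) v)).trans
    (mul_le_mul_of_nonneg_right h1 (norm_nonneg _))
  calc _ ≤ ‖vec (Q.image Prod.fst) u‖ * (‖G‖ * ‖Z‖ * ‖vec (Q.image Prod.snd) v‖) := by gcongr
    _ = _ := by ring

/-- on `H = ℓ²` with the diagonal masa `D`, if `κ ⊆ ℕ×ℕ` is a
Schur bounded pattern, then the Schur idempotent `Φ_κ` of Schur multiplication
by the 0-1 matrix of `κ` belongs to `𝔉H`; in particular `ran Φ_κ` is
hyperreflexive. -/
theorem stmt8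
    (D : StarSubalgebra ℂ (B (lp (fun _ : ℕ => ℂ) 2)))
    (hD : ∀ T : B (lp (fun _ : ℕ => ℂ) 2),
      T ∈ D ↔ ∀ i j : ℕ, i ≠ j → ⟪e i, T (e j)⟫_ℂ = 0)
    (κ : Set (ℕ × ℕ))
    (hκ : ∀ φ : ℕ × ℕ → ℂ, (∃ M : ℝ, ∀ p, ‖φ p‖ ≤ M) → (∀ p ∉ κ, φ p = 0) →
      ∃ Φφ : B (lp (fun _ : ℕ => ℂ) 2) →L[ℂ] B (lp (fun _ : ℕ => ℂ) 2),
        WStarContinuous (lp (fun _ : ℕ => ℂ) 2) Φφ ∧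
        ∀ (T : B (lp (fun _ : ℕ => ℂ) 2)) (i j : ℕ),
          ⟪e i, Φφ T (e j)⟫_ℂ = φ (i, j) * ⟪e i, T (e j)⟫_ℂ)
    (Φκ : B (lp (fun _ : ℕ => ℂ) 2) →L[ℂ] B (lp (fun _ : ℕ => ℂ) 2))
    (hcont : WStarContinuous (lp (fun _ : ℕ => ℂ) 2) Φκ)
    (hin : ∀ (T : B (lp (fun _ : ℕ => ℂ) 2)) (i j : ℕ), (i, j) ∈ κ →
      ⟪e i, Φκ T (e j)⟫_ℂ = ⟪e i, T (e j)⟫_ℂ)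
    (hout : ∀ (T : B (lp (fun _ : ℕ => ℂ) 2)) (i j : ℕ), (i, j) ∉ κ →
      ⟪e i, Φκ T (e j)⟫_ℂ = 0) :
    MemFH D Φκ ∧ Hyperreflexive (Set.range ⇑Φκ) := by
  classical
  obtain ⟨C, hC, hbd⟩ := exists_schurBoundedBy κ fun φ h1 h2 => by
    obtain ⟨Φ, -, hΦ⟩ := hκ φ h1 h2
    exact ⟨Φ, hΦ⟩
  obtain ⟨N, hN⟩ := exists_nat_gt (144 * C ^ 2)
  obtain ⟨κr, κc, hκrc, hr, hc⟩ :=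
    exists_row_col_decomposition N fun Q hQ => hbd.card_le_mul hC hN Q hQ
  have hent : ∀ T i j, ⟪e i, Φκ T (e j)⟫_ℂ = if (i, j) ∈ κ then ⟪e i, T (e j)⟫_ℂ else 0 := by
    intro T i j
    split_ifs with h
    · exact hin T i j h
    · exact hout T i j h
  have hidem : Φκ.comp Φκ = Φκ := by
    refine ContinuousLinearMap.ext fun T => ext_entries fun i j => ?_
    rw [ContinuousLinearMap.comp_apply, hent, hent T]
    split_ifs <;> rfl
  have hmod : ∀ A ∈ D, ∀ F ∈ D, ∀ T : B ℓ², Φκ (A * T * F) = A * Φκ T * F := by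
    intro A hA F hF T
    rw [hD] at hA hF
    have hprod : ∀ (S : B ℓ²) (i j : ℕ), ⟪e i, (A * S * F) (e j)⟫_ℂ =
        ⟪e i, A (e i)⟫_ℂ * ⟪e j, F (e j)⟫_ℂ * ⟪e i, S (e j)⟫_ℂ := by
      intro S i j
      change ⟪e i, A (S (F (e j)))⟫_ℂ = _
      rw [inner_diag_left hA, diag_apply_e hF, map_smul, inner_smul_right, mul_assoc]
      simp [inner_e, norm_e]
    refine ext_entries fun i j => ?_
    rw [hent, hprod, hprod, hent]
    split_ifs
    · rfl
    · rw [mul_zero]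
  have hlam : ∀ T : B ℓ², ‖T - Φκ T‖ ≤ 4 ^ (N + 1) * arveson T (Set.range Φκ) := by
    intro T
    refine norm_le_of_rectangles hκrc N hr hc _ ?_ _ (arveson_nonneg _ _) ?_
    · intro i j hij
      rw [sub_apply, inner_sub_right, hin T i j hij, sub_self]
    · intro E F hEF x y
      have h1 : ⟪vec E y, (T - Φκ T) (vec F x)⟫_ℂ = ⟪vec E y, T (vec F x)⟫_ℂ := by
        rw [inner_vec_vec, inner_vec_vec]
        refine Finset.sum_congr rfl fun i hi => Finset.sum_congr rfl fun j hj => ?_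
        rw [sub_apply, inner_sub_right, hout T i j (hEF i hi j hj), sub_zero]
      rw [h1]
      refine norm_rectangle_le (X := Set.range Φκ) T ⟨0, map_zero Φκ⟩ E F ?_ x y
      rintro _ ⟨S, rfl⟩ i hi j hj
      exact hout S i j (hEF i hi j hj)
  refine ⟨⟨⟨⟨hcont, hmod⟩, hidem⟩, 4 ^ (N + 1), by positivity, hlam⟩, 4 ^ (N + 1), by positivity, fun T => ?_⟩
  refine (Metric.infDist_le_dist_of_mem (Set.mem_range_self T)).trans ?_
  rw [dist_eq_norm]
  exact hlam T
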